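/- For any finished phase P of the algorithm TC, k_P·α ≤ OPT(P)·(k_ONL + 1)/(k_ONL + 1 − k_OPT), where OPT(P) is the minimum cost of serving the requests of P by an offline algorithm with cache size k_OPT < k_ONL + 1 that may start the phase with an arbitrary cache. -/

import Mathlib

open scoped Classical

/-!
Common setup for the online tree caching problem
(Bienkowski, Marcinkowski, Pacut, Schmid, Spyra, "Online Tree Caching").
-/

/-- A finite rooted tree on the vertex type `V`: every vertex has a parent,
the root is its own parent, and iterating `parent` from any vertex reaches the root. -/
structure RTree (V : Type) where
  root : V
  parent : V → V
  parent_root : parent root = root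
  reaches_root : ∀ v : V, ∃ n : ℕ, parent^[n] v = root

namespace RTree

variable {V : Type}

/-- The subtree `T(u)`: `u` together with all its descendants. -/
def subtree (T : RTree V) (u : V) : Set V :=
  {v | ∃ n : ℕ, T.parent^[n] v = u}

/-- `C` is a subforest of `T`: with every node it contains the whole subtree below it. -/
def Subforest (T : RTree V) (C : Set V) : Prop :=
  ∀ v ∈ C, T.subtree v ⊆ C

/-- `A` is a tree cap rooted at `v`: `A ⊆ T(v)`, `v ∈ A`, and `A` is closed under
taking the parent (towards `v`). -/
def TreeCap (T : RTree V) (v : V) (A : Set V) : Prop :=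
  A ⊆ T.subtree v ∧ v ∈ A ∧ ∀ u ∈ A, u ≠ v → T.parent u ∈ A

/-- `X` is a valid positive changeset for the cache `C`. -/
def ValidPos (T : RTree V) (C X : Set V) : Prop :=
  X.Nonempty ∧ X ∩ C = ∅ ∧ T.Subforest (C ∪ X)

/-- `X` is a valid negative changeset for the cache `C`. -/
def ValidNeg (T : RTree V) (C X : Set V) : Prop :=
  X.Nonempty ∧ X ⊆ C ∧ T.Subforest (C \ X)

/-- `X` is a valid changeset for the cache `C`. -/
def Valid (T : RTree V) (C X : Set V) : Prop :=
  T.ValidPos C X ∨ T.ValidNeg C X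

/-- `w` is the root of a tree (connected component) of the subforest `C`. -/
def IsCompRoot (T : RTree V) (C : Set V) (w : V) : Prop :=
  w ∈ C ∧ (w = T.root ∨ T.parent w ∉ C)

/-- The depth of a node: its distance to the root. -/
noncomputable def depth [DecidableEq V] (T : RTree V) (v : V) : ℕ :=
  Nat.find (T.reaches_root v)

/-- The height `h(T)` of the tree: its number of levels. -/
noncomputable def height [Fintype V] [DecidableEq V] (T : RTree V) : ℕ :=
  (Finset.univ.sup fun v => T.depth v) + 1

end RTree

/-- A request: a node together with a sign (`true` = positive, `false` = negative). -/
abbrev Request (V : Type) := V × Bool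

/-- The request `r` incurs cost `1` when the cache is `C`
(a positive request to a non-cached node, or a negative request to a cached node). -/
def Costly {V : Type} (r : Request V) (C : Set V) : Prop :=
  (r.2 = true ∧ r.1 ∉ C) ∨ (r.2 = false ∧ r.1 ∈ C)

/-- The sum of the counters `f` over the set of nodes `A`. -/
noncomputable def cntSum {V : Type} [Fintype V] (f : V → ℕ) (A : Set V) : ℕ :=
  ∑ v : V, A.indicator f v

/-- The number of nodes of a changeset (`0` for no changeset). -/
noncomputable def chgSize {V : Type} : Option (Set V) → ℕ
  | none => 0
  | some X => X.ncard

/-- One phase of the algorithm `TC` on the request sequence `req` (the request of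
round `t ≥ 1` is `req t`), starting at time `0` with an empty cache.
`cache t` is the cache contents during round `t`; `cnt t` are the counter values just
after serving the request of round `t` (used for the decision at time `t`);
`chg t` is the changeset applied at time `t` (right after round `t`), if any. -/
structure TCPhase {V : Type} [Fintype V] [DecidableEq V]
    (T : RTree V) (α : ℕ) (req : ℕ → Request V) where
  cache : ℕ → Set V
  cnt : ℕ → V → ℕ
  chg : ℕ → Option (Set V)
  cache_subforest : ∀ t, T.Subforest (cache t)
  cache_zero : cache 0 = ∅
  cnt_zero : ∀ v, cnt 0 v = 0
  cnt_rec : ∀ t v, cnt (t + 1) v =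
    (if ∃ X, chg t = some X ∧ v ∈ X then 0 else cnt t v)
    + (if (req (t + 1)).1 = v ∧ Costly (req (t + 1)) (cache (t + 1)) then 1 else 0)
  step_some : ∀ t X, chg t = some X →
    T.Valid (cache t) X ∧
    X.ncard * α ≤ cntSum (cnt t) X ∧
    (∀ Y, T.Valid (cache t) Y → X ⊂ Y → cntSum (cnt t) Y < Y.ncard * α) ∧
    cache (t + 1) = if T.ValidPos (cache t) X then cache t ∪ X else cache t \ X
  step_none : ∀ t, chg t = none →
    cache (t + 1) = cache t ∧
    ∀ X, T.Valid (cache t) X → cntSum (cnt t) X < X.ncard * α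

namespace TCPhase

variable {V : Type} [Fintype V] [DecidableEq V]
  {T : RTree V} {α : ℕ} {req : ℕ → Request V}

/-- The counter values at time `t`, right after the cache change at time `t`
(counters of fetched/evicted nodes are reset to `0`). -/
noncomputable def cntPost (E : TCPhase T α req) (t : ℕ) (v : V) : ℕ :=
  if ∃ X, E.chg t = some X ∧ v ∈ X then 0 else E.cnt t v

/-- `last_v(t)`: the last time strictly before `t` at which `v` changed its
cached/non-cached state (`0`, the beginning of the phase, if there is none). -/
noncomputable def lastChg (E : TCPhase T α req) (v : V) (t : ℕ) : ℕ :=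
  ((Finset.range t).filter fun s => ¬ ((v ∈ E.cache s) ↔ v ∈ E.cache (s + 1))).sup id

/-- The slot `(v, r)` belongs to the field `F^t`. -/
def inField (E : TCPhase T α req) (t : ℕ) (v : V) (r : ℕ) : Prop :=
  ∃ X, E.chg t = some X ∧ v ∈ X ∧ E.lastChg v t < r ∧ r ≤ t

/-- The number of requests of the sequence `ρ` lying in slots of `F^t_{≤ τ} ∩ D`. -/
noncomputable def fieldReqIn (E : TCPhase T α req) (ρ : ℕ → Request V)
    (t : ℕ) (D : Set V) (τ : ℕ) : ℕ :=
  ((Finset.Icc 1 t).filter fun r => r ≤ τ ∧ (ρ r).1 ∈ D ∧ E.inField t (ρ r).1 r).card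

/-- `req(F^t)`: the number of requests of `ρ` in slots of the field `F^t`. -/
noncomputable def fieldReq (E : TCPhase T α req) (ρ : ℕ → Request V) (t : ℕ) : ℕ :=
  E.fieldReqIn ρ t Set.univ t

/-- `size(F^t_{≤ τ} ∩ D)`: the number of distinct nodes having a slot in `F^t_{≤ τ} ∩ D`. -/
noncomputable def fieldSizeIn (E : TCPhase T α req) (t : ℕ) (D : Set V) (τ : ℕ) : ℕ :=
  (Finset.univ.filter fun v : V => v ∈ D ∧ ∃ r, r ≤ τ ∧ E.inField t v r).card

/-- The standing assumption: no positive requests are given to cached nodes and no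
negative requests to non-cached ones (so every request incurs cost `1` for `TC`). -/
def GoodReq (E : TCPhase T α req) : Prop :=
  ∀ t, 1 ≤ t →
    ((req t).2 = true → (req t).1 ∉ E.cache t) ∧
    ((req t).2 = false → (req t).1 ∈ E.cache t)

/-- The phase consists of rounds `1, …, tEnd`: no cache of `TC` before time `tEnd`
exceeds the capacity `kONL` (at time `tEnd` the triggered fetch, if any, is performed
even if it exceeds the capacity, and is followed by the final eviction). -/
def PhaseEnd (E : TCPhase T α req) (kONL tEnd : ℕ) : Prop :=
  ∀ t, t < tEnd → (E.cache (t + 1)).ncard ≤ kONL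

/-- `k_P`: the number of nodes in `TC`'s cache at the end of the phase
(after the fetch at time `tEnd`, before the final eviction). -/
noncomputable def kP (E : TCPhase T α req) (tEnd : ℕ) : ℕ :=
  (E.cache (tEnd + 1)).ncard

/-- The phase ending at `tEnd` is finished: the fetch at time `tEnd` exceeded the
capacity `kONL`. -/
def FinishedAt (E : TCPhase T α req) (kONL tEnd : ℕ) : Prop :=
  E.PhaseEnd kONL tEnd ∧ kONL < E.kP tEnd

/-- `size(𝓕)`: the total size of all fields of the phase. -/
noncomputable def sizeFields (E : TCPhase T α req) (tEnd : ℕ) : ℕ :=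
  ∑ t ∈ Finset.Icc 1 tEnd, chgSize (E.chg t)

/-- `req(F^∞)`: the number of requests of the phase lying in slots of the open field
(slots covered by no field of the phase). -/
noncomputable def openReq (E : TCPhase T α req) (tEnd : ℕ) : ℕ :=
  ((Finset.Icc 1 tEnd).filter fun r => ∀ t, t ≤ tEnd → ¬ E.inField t (req r).1 r).card

/-- `TC(P)`: the total cost paid by `TC` during the phase: serving the requests,
fetching/evicting the applied changesets (`α` per node), and the final eviction
(`α · k_P`) if the phase is finished. -/
noncomputable def tcCost (E : TCPhase T α req) (kONL tEnd : ℕ) : ℕ :=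
  ((Finset.Icc 1 tEnd).filter fun r => Costly (req r) (E.cache r)).card
  + α * E.sizeFields tEnd
  + (if kONL < E.kP tEnd then α * E.kP tEnd else 0)

/-- The tree cap `Y` (rooted at `u`, inside the negative field `F^t`) is proper for
the request sequence `ρ`: it holds `req(F^t ∩ Y) = |Y| · α`, and `F^t_{≤ τ} ∩ D` is
not over-requested for every tree cap `D ⊆ Y` rooted at `u` and every time `τ ≤ t`. -/
def Proper (E : TCPhase T α req) (ρ : ℕ → Request V) (t : ℕ) (u : V) (Y : Set V) : Prop :=
  E.fieldReqIn ρ t Y t = Y.ncard * α ∧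
  ∀ (D : Set V) (τ : ℕ), T.TreeCap u D → D ⊆ Y → τ ≤ t →
    E.fieldReqIn ρ t D τ ≤ E.fieldSizeIn t D τ * α

end TCPhase

/-- `D` is a feasible cache schedule for an (offline) algorithm with cache size `k`:
at every time the cache is a subforest of `T` of at most `k` nodes. -/
def IsSchedule {V : Type} (T : RTree V) (k : ℕ) (D : ℕ → Set V) : Prop :=
  ∀ t, T.Subforest (D t) ∧ (D t).ncard ≤ k

/-- The cost of serving the requests of rounds `a, …, b` of `ρ` when the cache during
round `r` is `D r`. -/
noncomputable def serveCost {V : Type} (ρ : ℕ → Request V) (D : ℕ → Set V) (a b : ℕ) : ℕ :=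
  ((Finset.Icc a b).filter fun r => Costly (ρ r) (D r)).card

/-- The reorganization cost of the schedule `D` (`α` per fetched or evicted node) over
the times `a, …, b - 1` (the change at time `t` leads from `D t` to `D (t+1)`). -/
noncomputable def moveCost {V : Type} (α : ℕ) (D : ℕ → Set V) (a b : ℕ) : ℕ :=
  α * ∑ t ∈ Finset.Ico a b, ((D (t + 1) \ D t).ncard + (D t \ D (t + 1)).ncard)

/-- `OPT`: the minimum cost of serving rounds `a, …, b` of `ρ` by an offline algorithm
with cache size `k` that may start with an arbitrary cache. -/
noncomputable def optCostFrom {V : Type} (T : RTree V) (α k : ℕ)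
    (ρ : ℕ → Request V) (a b : ℕ) : ℕ :=
  sInf {n | ∃ D : ℕ → Set V, IsSchedule T k D ∧
    n = serveCost ρ D a b + moveCost α D a b}

/-- `OPT`: the minimum cost of serving rounds `1, …, b` of `ρ` by an offline algorithm
with cache size `k` that starts with the empty cache. -/
noncomputable def optCostEmpty {V : Type} (T : RTree V) (α k : ℕ)
    (ρ : ℕ → Request V) (b : ℕ) : ℕ :=
  sInf {n | ∃ D : ℕ → Set V, IsSchedule T k D ∧ D 0 = ∅ ∧
    n = serveCost ρ D 1 b + moveCost α D 0 b}

/-- `ρ'` is obtained from `ρ` by legally shifting requests: signs are preserved, every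
positive request is moved to a descendant of its node (or kept), and every negative
request is moved to an ancestor of its node (or kept). -/
def LegalShift {V : Type} (T : RTree V) (ρ ρ' : ℕ → Request V) : Prop :=
  ∀ t, (ρ' t).2 = (ρ t).2 ∧
    ((ρ t).2 = true → (ρ' t).1 ∈ T.subtree (ρ t).1) ∧
    ((ρ t).2 = false → (ρ t).1 ∈ T.subtree (ρ' t).1)

/-- A full run of the algorithm `TC` with cache capacity `kONL` on the request
sequence `req`, including phase restarts: whenever the fetch of a saturated changeset
would exceed the capacity, `TC` instead evicts its whole cache and a new phase starts
(`newPhase t` holds, and all counters are reset). -/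
structure TCRun {V : Type} [Fintype V] [DecidableEq V]
    (T : RTree V) (α kONL : ℕ) (req : ℕ → Request V) where
  cache : ℕ → Set V
  cnt : ℕ → V → ℕ
  chg : ℕ → Option (Set V)
  newPhase : ℕ → Prop
  cache_subforest : ∀ t, T.Subforest (cache t)
  cache_zero : cache 0 = ∅
  cnt_zero : ∀ v, cnt 0 v = 0
  capacity : ∀ t, (cache t).ncard ≤ kONL
  cnt_rec : ∀ t v, cnt (t + 1) v =
    (if newPhase t ∨ ∃ X, chg t = some X ∧ v ∈ X then 0 else cnt t v)
    + (if (req (t + 1)).1 = v ∧ Costly (req (t + 1)) (cache (t + 1)) then 1 else 0)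
  step_some : ∀ t X, chg t = some X →
    T.Valid (cache t) X ∧
    X.ncard * α ≤ cntSum (cnt t) X ∧
    (∀ Y, T.Valid (cache t) Y → X ⊂ Y → cntSum (cnt t) Y < Y.ncard * α) ∧
    ((T.ValidPos (cache t) X ∧ (cache t ∪ X).ncard ≤ kONL ∧
        cache (t + 1) = cache t ∪ X ∧ ¬ newPhase t) ∨
     (T.ValidPos (cache t) X ∧ kONL < (cache t ∪ X).ncard ∧
        cache (t + 1) = ∅ ∧ newPhase t) ∨
     (T.ValidNeg (cache t) X ∧ cache (t + 1) = cache t \ X ∧ ¬ newPhase t))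
  step_none : ∀ t, chg t = none →
    cache (t + 1) = cache t ∧ ¬ newPhase t ∧
    ∀ X, T.Valid (cache t) X → cntSum (cnt t) X < X.ncard * α

/-- `TC(I)`: the total cost paid by the run `E` of `TC` on the rounds `1, …, N`:
serving the requests, plus `α` per fetched/evicted node (on a phase restart the whole
cache is evicted). -/
noncomputable def TCRun.cost {V : Type} [Fintype V] [DecidableEq V]
    {T : RTree V} {α kONL : ℕ} {req : ℕ → Request V}
    (E : TCRun T α kONL req) (N : ℕ) : ℕ :=
  ((Finset.Icc 1 N).filter fun r => Costly (req r) (E.cache r)).card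
  + α * ∑ t ∈ Finset.Icc 1 N,
      (if E.newPhase t then (E.cache t).ncard else chgSize (E.chg t))

namespace RTree

variable {V : Type} {T : RTree V} {A B : Set V}

theorem Subforest.union (hA : T.Subforest A) (hB : T.Subforest B) : T.Subforest (A ∪ B) := by
  rintro v (hv | hv)
  · exact (hA v hv).trans Set.subset_union_left
  · exact (hB v hv).trans Set.subset_union_right

theorem Subforest.inter (hA : T.Subforest A) (hB : T.Subforest B) : T.Subforest (A ∩ B) :=
  fun v hv => Set.subset_inter (hA v hv.1) (hB v hv.2)

theorem Valid.nonempty (h : T.Valid A B) : B.Nonempty := h.elim And.left And.left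

theorem ValidPos.notMem (h : T.ValidPos A B) : ∀ v ∈ B, v ∉ A :=
  fun v hB hA => Set.notMem_empty v (h.2.1 ▸ Set.mem_inter hB hA)

theorem ValidNeg.not_validPos (h : T.ValidNeg A B) : ¬ T.ValidPos A B := by
  intro hp
  obtain ⟨v, hv⟩ := h.1
  exact hp.notMem v hv (h.2.1 hv)

end RTree

section cntSum

variable {V : Type} [Fintype V] {f g : V → ℕ} {A B : Set V}

theorem cntSum_union (h : A ∩ B = ∅) : cntSum f (A ∪ B) = cntSum f A + cntSum f B := by
  unfold cntSum
  rw [← Finset.sum_add_distrib, Set.indicator_union_of_disjoint (Set.disjoint_iff_inter_eq_empty.2 h)]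

theorem cntSum_mono (h : ∀ v ∈ A, f v ≤ g v) : cntSum f A ≤ cntSum g A :=
  Finset.sum_le_sum fun v _ => Set.indicator_le_indicator' (h v)

theorem cntSum_congr (h : ∀ v ∈ A, f v = g v) : cntSum f A = cntSum g A :=
  le_antisymm (cntSum_mono fun v hv => (h v hv).le) (cntSum_mono fun v hv => (h v hv).ge)

theorem cntSum_eq_zero (h : ∀ v ∈ A, f v = 0) : cntSum f A = 0 :=
  Finset.sum_eq_zero fun v _ => by
    by_cases hv : v ∈ A <;> simp [hv, h]

theorem cntSum_empty : cntSum f ∅ = 0 := cntSum_eq_zero (by simp)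

/-- Increasing one counter by one increases the sum over `A` by one if the counter is in `A`. -/
theorem cntSum_add_single (w : V) (p : Prop) :
    cntSum (fun v => f v + if w = v ∧ p then 1 else 0) A
      = cntSum f A + if w ∈ A ∧ p then 1 else 0 := by
  unfold cntSum
  have : ∀ v, A.indicator (fun v => f v + if w = v ∧ p then 1 else 0) v
      = A.indicator f v + if w = v then (if w ∈ A ∧ p then 1 else 0) else 0 := by
    intro v
    by_cases hv : v ∈ A <;> by_cases hw : w = v
    · subst hw; simp [hv]
    · simp [hv, hw]
    · subst hw; simp [hv]
    · simp [hv, hw]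
  simp only [this, Finset.sum_add_distrib, Finset.sum_ite_eq, Finset.mem_univ, if_true]

theorem ncard_union_of_inter_eq_empty (h : A ∩ B = ∅) :
    (A ∪ B).ncard = A.ncard + B.ncard :=
  Set.ncard_union_eq (Set.disjoint_iff_inter_eq_empty.2 h) (Set.toFinite _) (Set.toFinite _)

end cntSum

namespace TCPhase

variable {V : Type} [Fintype V] [DecidableEq V]
  {T : RTree V} {α : ℕ} {req : ℕ → Request V}

theorem cntSum_cnt_succ (E : TCPhase T α req) (t : ℕ) (A : Set V) :
    cntSum (E.cnt (t + 1)) A = cntSum (E.cntPost t) A +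
      if (req (t + 1)).1 ∈ A ∧ Costly (req (t + 1)) (E.cache (t + 1)) then 1 else 0 := by
  rw [← cntSum_add_single]
  refine cntSum_congr fun v _ => ?_
  rw [E.cnt_rec, cntPost]
  congr

theorem cntPost_of_none (E : TCPhase T α req) {t : ℕ} (h : E.chg t = none) :
    E.cntPost t = E.cnt t := by
  ext v; simp [cntPost, h]

theorem cntPost_of_mem (E : TCPhase T α req) {t : ℕ} {X : Set V} (h : E.chg t = some X) {v : V}
    (hv : v ∈ X) : E.cntPost t v = 0 := by
  simp [cntPost, h, hv]

theorem cntPost_of_notMem (E : TCPhase T α req) {t : ℕ} {X : Set V} (h : E.chg t = some X) {v : V}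
    (hv : v ∉ X) : E.cntPost t v = E.cnt t v := by
  simp [cntPost, h, hv]

theorem cntSum_cntPost (E : TCPhase T α req) {t : ℕ} {X : Set V} (h : E.chg t = some X)
    (Y : Set V) : cntSum (E.cntPost t) Y = cntSum (E.cnt t) (Y \ X) := by
  have hd : (Y \ X) ∩ (Y ∩ X) = ∅ := by ext v; simp; tauto
  conv_lhs => rw [← Set.sdiff_union_inter Y X, cntSum_union hd]
  rw [cntSum_eq_zero (A := Y ∩ X) fun v hv => E.cntPost_of_mem h hv.2, add_zero]
  exact cntSum_congr fun v hv => E.cntPost_of_notMem h hv.2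

theorem chg_zero (E : TCPhase T α req) (hα : 1 ≤ α) : E.chg 0 = none := by
  cases h : E.chg 0 with
  | none => rfl
  | some X =>
    obtain ⟨hv, hs, -⟩ := E.step_some 0 X h
    rw [cntSum_eq_zero fun v _ => E.cnt_zero v] at hs
    have := (Set.ncard_pos (Set.toFinite X)).2 hv.nonempty
    have := Nat.mul_pos this hα
    omega

/-- A changeset disjoint from the applied one `X` and of the same sign is unsaturated, because its
union with `X` is unsaturated by maximality. -/
theorem cntSum_lt_of_union (E : TCPhase T α req) {t : ℕ} {X Y : Set V} (h : E.chg t = some X)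
    (hY : Y.Nonempty) (hd : X ∩ Y = ∅) (hv : T.Valid (E.cache t) (X ∪ Y)) :
    cntSum (E.cnt t) Y < Y.ncard * α := by
  obtain ⟨-, hs, hm, -⟩ := E.step_some t X h
  have hlt : X ⊂ X ∪ Y := by
    refine ⟨Set.subset_union_left, fun hsub => ?_⟩
    obtain ⟨y, hy⟩ := hY
    have : y ∈ X ∩ Y := ⟨hsub (Or.inr hy), hy⟩
    simp [hd] at this
  have := hm _ hv hlt
  rw [cntSum_union hd, ncard_union_of_inter_eq_empty hd, add_mul] at this
  omega

/-- Right after the cache change at time `t`, no valid changeset is saturated. -/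
theorem cntSum_cntPost_lt (E : TCPhase T α req) (hα : 1 ≤ α) (t : ℕ) :
    ∀ Y, T.Valid (E.cache (t + 1)) Y → cntSum (E.cntPost t) Y < Y.ncard * α := by
  have hnone : ∀ t, E.chg t = none →
      ∀ Y, T.Valid (E.cache (t + 1)) Y → cntSum (E.cntPost t) Y < Y.ncard * α := by
    intro t h Y hY
    obtain ⟨hc, hm⟩ := E.step_none t h
    rw [E.cntPost_of_none h]
    exact hm Y (hc ▸ hY)
  induction t with
  | zero => exact hnone 0 (E.chg_zero hα)
  | succ t ih =>
    cases h : E.chg (t + 1) with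
    | none => exact hnone _ h
    | some X =>
      intro Y hY
      obtain ⟨hX, hs, -, hc⟩ := E.step_some _ X h
      have hreq : (req (t + 1)).1 ∈ X := by
        by_contra hn
        have := ih X hX
        rw [E.cntSum_cnt_succ] at hs
        simp only [hn, false_and, if_false] at hs
        omega
      rw [E.cntSum_cntPost h]
      have hle : (Y \ X).ncard * α ≤ Y.ncard * α :=
        Nat.mul_le_mul_right _ (Set.ncard_le_ncard Set.sdiff_subset (Set.toFinite _))
      rcases (Y \ X).eq_empty_or_nonempty with he | hne
      · rw [he, cntSum_empty]
        exact Nat.mul_pos ((Set.ncard_pos (Set.toFinite Y)).2 hY.nonempty) hα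
      refine lt_of_lt_of_le ?_ hle
      have opposite : T.Valid (E.cache (t + 1)) (Y \ X) →
          cntSum (E.cnt (t + 1)) (Y \ X) < (Y \ X).ncard * α := by
        intro hv
        rw [E.cntSum_cnt_succ]
        simpa [hreq] using ih _ hv
      have hCs := E.cache_subforest (t + 1)
      rcases hX with hX | hX
      · rw [if_pos hX] at hc
        rw [hc] at hY
        rcases hY with hY | hY
        · refine E.cntSum_lt_of_union h hne (by simp) (Or.inl ⟨hX.1.mono Set.subset_union_left, ?_, ?_⟩)
          · have h1 := hX.notMem
            have h2 := hY.2.1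
            grind
          · have := hY.2.2
            rwa [Set.union_assoc, ← Set.union_sdiff_self (s := X)] at this
        · refine opposite (Or.inr ⟨hne, ?_, ?_⟩)
          · have h2 := hY.2.1
            grind
          · have := hY.2.2.inter hCs
            have he : E.cache (t + 1) \ (Y \ X)
                = ((E.cache (t + 1) ∪ X) \ Y) ∩ E.cache (t + 1) := by
              have h1 := hX.notMem
              grind
            rwa [he]
      · rw [if_neg hX.not_validPos] at hc
        rw [hc] at hY
        rcases hY with hY | hY
        · refine opposite (Or.inl ⟨hne, ?_, ?_⟩)
          · have h2 := hY.2.1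
            grind
          · have := hY.2.2.union hCs
            have he : E.cache (t + 1) ∪ (Y \ X)
                = (E.cache (t + 1) \ X ∪ Y) ∪ E.cache (t + 1) := by
              have h1 := hX.2.1
              grind
            rwa [he]
        · refine E.cntSum_lt_of_union h hne (by simp) (Or.inr ⟨hX.1.mono Set.subset_union_left, ?_, ?_⟩)
          · have h1 := hX.2.1
            have h2 := hY.2.1
            grind
          · have := hY.2.2
            rwa [Set.sdiff_sdiff, ← Set.union_sdiff_self (s := X)] at this

/-- The part of a fetched changeset outside a subforest `U` received at least `α` requests per
node. -/
theorem ncard_diff_mul_le_cntSum (E : TCPhase T α req) (hα : 1 ≤ α) {t : ℕ} {X U : Set V}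
    (h : E.chg (t + 1) = some X) (hX : T.ValidPos (E.cache (t + 1)) X) (hU : T.Subforest U) :
    (X \ U).ncard * α ≤ cntSum (E.cnt (t + 1)) (X \ U) := by
  obtain ⟨-, hs, -, -⟩ := E.step_some _ X h
  have hd : (X \ U) ∩ (X ∩ U) = ∅ := by grind
  have hle : cntSum (E.cnt (t + 1)) (X ∩ U) ≤ (X ∩ U).ncard * α := by
    rcases (X ∩ U).eq_empty_or_nonempty with he | hne
    · simp [he, cntSum_empty]
    have hv : T.ValidPos (E.cache (t + 1)) (X ∩ U) := by
      refine ⟨hne, ?_, ?_⟩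
      · have := hX.notMem
        grind
      · rw [Set.union_inter_distrib_left]
        exact hX.2.2.inter ((E.cache_subforest _).union hU)
    have := E.cntSum_cntPost_lt hα t _ (Or.inl hv)
    rw [E.cntSum_cnt_succ]
    split_ifs <;> omega
  rw [← Set.sdiff_union_inter X U, cntSum_union hd, ncard_union_of_inter_eq_empty hd, add_mul] at hs
  omega

/-- The positive requests outside a subforest `U` pay `α` for every node of the cache outside `U`,
and for the current counters of the other nodes outside `U`. -/
theorem cache_diff_mul_add_cntSum_le (E : TCPhase T α req) (hα : 1 ≤ α) {U : Set V}
    (hU : T.Subforest U) (t : ℕ) :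
    (E.cache (t + 1) \ U).ncard * α + cntSum (E.cntPost t) (E.cache (t + 1) ∪ U)ᶜ ≤
      ((Finset.Icc 1 t).filter fun r => (req r).2 = true ∧ (req r).1 ∉ U).card := by
  induction t with
  | zero =>
    have h := E.chg_zero hα
    rw [(E.step_none 0 h).1, E.cache_zero, E.cntPost_of_none h,
      cntSum_eq_zero fun v _ => E.cnt_zero v]
    simp
  | succ t ih =>
    have hround : (E.cache (t + 1) \ U).ncard * α
        + cntSum (E.cnt (t + 1)) (E.cache (t + 1) ∪ U)ᶜ ≤
        ((Finset.Icc 1 (t + 1)).filter fun r => (req r).2 = true ∧ (req r).1 ∉ U).card := by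
      rw [E.cntSum_cnt_succ, ← Finset.insert_Icc_right_eq_Icc_add_one (by omega),
        Finset.filter_insert]
      split_ifs with h1 h2 h2
      · rw [Finset.card_insert_of_notMem (by simp)]
        omega
      · exfalso
        simp only [Costly, Set.mem_compl_iff, Set.mem_union] at h1
        tauto
      · rw [Finset.card_insert_of_notMem (by simp)]
        omega
      · omega
    refine le_trans ?_ hround
    cases h : E.chg (t + 1) with
    | none => rw [(E.step_none _ h).1, E.cntPost_of_none h]
    | some X =>
      obtain ⟨hX, -, -, hc⟩ := E.step_some _ X h
      rw [E.cntSum_cntPost h, hc]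
      rcases hX with hX | hX
      · rw [if_pos hX]
        have hpay := E.ncard_diff_mul_le_cntSum hα h hX hU
        have hXC := hX.notMem
        have h1 : (E.cache (t + 1) ∪ U)ᶜ = ((E.cache (t + 1) ∪ X ∪ U)ᶜ \ X) ∪ (X \ U) := by grind
        have h2 : (E.cache (t + 1) ∪ X) \ U = (E.cache (t + 1) \ U) ∪ (X \ U) :=
          Set.union_sdiff_distrib
        rw [h1, h2, cntSum_union (by grind), ncard_union_of_inter_eq_empty (by grind), add_mul]
        omega
      · rw [if_neg hX.not_validPos]
        have hXC := hX.2.1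
        have h1 : (E.cache (t + 1) \ X ∪ U)ᶜ \ X = (E.cache (t + 1) ∪ U)ᶜ \ X := by grind
        have h2 : (E.cache (t + 1) ∪ U)ᶜ \ X = (E.cache (t + 1) ∪ U)ᶜ := by grind
        rw [h1, h2]
        have : ((E.cache (t + 1) \ X) \ U).ncard ≤ (E.cache (t + 1) \ U).ncard :=
          Set.ncard_le_ncard (by grind) (Set.toFinite _)
        gcongr

end TCPhase

/-- Every node cached at some round but not at the first one is fetched at least once. -/
theorem ncard_visited_diff_le {V : Type} [Fintype V] (D : ℕ → Set V) (b : ℕ) :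
    ({v | ∃ r ∈ Finset.Icc 1 b, v ∈ D r} \ D 1).ncard ≤
      ∑ t ∈ Finset.Ico 1 b, (D (t + 1) \ D t).ncard := by
  induction b with
  | zero => simp
  | succ b ih =>
    rcases Nat.eq_zero_or_pos b with rfl | hb
    · simp
    rw [Finset.sum_Ico_succ_top hb]
    refine le_trans (Set.ncard_le_ncard (t := ({v | ∃ r ∈ Finset.Icc 1 b, v ∈ D r} \ D 1)
      ∪ (D (b + 1) \ D b)) ?_ (Set.toFinite _))
      ((Set.ncard_union_le _ _).trans (Nat.add_le_add_right ih _))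
    rintro v ⟨⟨r, hr, hv⟩, hv1⟩
    rw [Finset.mem_Icc] at hr
    rcases Nat.lt_or_ge b r with h | h
    · obtain rfl : r = b + 1 := by omega
      by_cases hvb : v ∈ D b
      · exact Or.inl ⟨⟨b, by simp; omega, hvb⟩, hv1⟩
      · exact Or.inr ⟨hv, hvb⟩
    · exact Or.inl ⟨⟨r, by simp; omega, hv⟩, hv1⟩

theorem exists_schedule_cost_eq_optCostFrom {V : Type} (T : RTree V) (α k : ℕ)
    (ρ : ℕ → Request V) (a b : ℕ) :
    ∃ D : ℕ → Set V, IsSchedule T k D ∧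
      optCostFrom T α k ρ a b = serveCost ρ D a b + moveCost α D a b :=
  Nat.sInf_mem (s := {n | ∃ D : ℕ → Set V, IsSchedule T k D ∧
    n = serveCost ρ D a b + moveCost α D a b})
    ⟨_, fun _ => ∅, fun _ => ⟨fun v hv => hv.elim, by simp⟩, rfl⟩

/-- Any schedule of size `k` pays `α` for each node of the final cache of `TC` that it did not
hold in the first round. -/
theorem TCPhase.kP_mul_le_cost {V : Type} [Fintype V] [DecidableEq V]
    {T : RTree V} {α : ℕ} {req : ℕ → Request V} (E : TCPhase T α req) (hα : 1 ≤ α)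
    (k tEnd : ℕ) {D : ℕ → Set V} (hD : IsSchedule T k D) :
    E.kP tEnd * α ≤ serveCost req D 1 tEnd + moveCost α D 1 tEnd + k * α := by
  obtain ⟨U, hUdef⟩ : ∃ U, U = {v | ∃ r ∈ Finset.Icc 1 tEnd, v ∈ D r} := ⟨_, rfl⟩
  have hU : T.Subforest U := by
    subst hUdef
    rintro v ⟨r, hr, hv⟩ w hw
    exact ⟨r, hr, (hD r).1 v hv hw⟩
  have hserve : (E.cache (tEnd + 1) \ U).ncard * α ≤ serveCost req D 1 tEnd := by
    refine le_trans (Nat.le_of_add_right_le (E.cache_diff_mul_add_cntSum_le hα hU tEnd))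
      (Finset.card_le_card fun r hr => ?_)
    rw [Finset.mem_filter] at hr ⊢
    exact ⟨hr.1, Or.inl ⟨hr.2.1, fun hv => hr.2.2 (hUdef ▸ ⟨r, hr.1, hv⟩)⟩⟩
  have hmove : (U \ D 1).ncard * α ≤ moveCost α D 1 tEnd := by
    rw [mul_comm, moveCost, hUdef]
    refine Nat.mul_le_mul_left _ ((ncard_visited_diff_le D tEnd).trans ?_)
    exact Finset.sum_le_sum fun t _ => Nat.le_add_right _ _
  have hcover : E.kP tEnd ≤ (E.cache (tEnd + 1) \ U).ncard + (U \ D 1).ncard + k := by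
    have hsub : E.cache (tEnd + 1) ⊆ (E.cache (tEnd + 1) \ U) ∪ (U \ D 1) ∪ D 1 := by
      intro v hv
      simp only [Set.mem_union, Set.mem_sdiff]
      tauto
    have h1 := Set.ncard_le_ncard hsub (Set.toFinite _)
    have h2 := Set.ncard_union_le ((E.cache (tEnd + 1) \ U) ∪ (U \ D 1)) (D 1)
    have h3 := Set.ncard_union_le (E.cache (tEnd + 1) \ U) (U \ D 1)
    have h4 := (hD 1).2
    rw [TCPhase.kP]
    omega
  have := Nat.mul_le_mul_right α hcover
  rw [add_mul, add_mul] at this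
  omega

/-- for any finished phase `P` of `TC`,
`k_P·α ≤ OPT(P)·(kONL + 1)/(kONL + 1 − kOPT)`, where `OPT(P)` is the optimal offline
cost of serving the requests of `P` with cache size `kOPT < kONL + 1`, starting from an
arbitrary cache. -/
theorem finished_phase_kP_bound {V : Type} [Fintype V] [DecidableEq V]
    {T : RTree V} {α : ℕ} {req : ℕ → Request V}
    (E : TCPhase T α req) (hα : 1 ≤ α) (hgood : E.GoodReq)
    (kONL kOPT tEnd : ℕ) (hk : kOPT < kONL + 1) (hfin : E.FinishedAt kONL tEnd) :
    ((E.kP tEnd : ℝ) * (α : ℝ)) ≤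
      (optCostFrom T α kOPT req 1 tEnd : ℝ) * ((kONL : ℝ) + 1) /
        ((kONL : ℝ) + 1 - (kOPT : ℝ)) := by
  obtain ⟨D, hD, hopt⟩ := exists_schedule_cost_eq_optCostFrom T α kOPT req 1 tEnd
  have hcost := E.kP_mul_le_cost hα kOPT tEnd hD
  rw [← hopt] at hcost
  have hcost' : (E.kP tEnd : ℝ) * α ≤ optCostFrom T α kOPT req 1 tEnd + kOPT * α := by
    exact_mod_cast hcost
  have hkP : (kONL : ℝ) + 1 ≤ E.kP tEnd := by exact_mod_cast hfin.2
  have hk' : (kOPT : ℝ) < kONL + 1 := by exact_mod_cast hk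
  rw [le_div_iff₀ (by linarith)]
  have h1 : (kOPT : ℝ) * α * (kONL + 1) ≤ kOPT * α * E.kP tEnd := by gcongr
  have h2 := mul_le_mul_of_nonneg_right hcost' (by positivity : (0 : ℝ) ≤ kONL + 1)
  linarith
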